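/- Fix n ≥ 0 and let γ_k denote the Taylor coefficients at 0 of T_n(z)√(1−z), so T_n(z)√(1−z) = ∑_{k=0}^∞ γ_k z^k. Then γ_k ≤ 0 for every k ≥ 1, and γ_k < 0 for every k ≥ n + 1. -/

import Mathlib

open Finset

open PowerSeries in
theorem hasSum_coeff_mul {p q : PowerSeries ℝ} {f g : ℂ → ℂ}
    (hf : ∀ᶠ z : ℂ in nhds 0, HasSum (fun k : ℕ => ((coeff k p : ℝ) : ℂ) * z ^ k) (f z))
    (hg : ∀ᶠ z : ℂ in nhds 0, HasSum (fun k : ℕ => ((coeff k q : ℝ) : ℂ) * z ^ k) (g z)) :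
    ∀ᶠ z : ℂ in nhds 0,
      HasSum (fun k : ℕ => ((coeff k (p * q) : ℝ) : ℂ) * z ^ k) (f z * g z) := by
  filter_upwards [hf, hg] with z h₁ h₂
  have n₁ := summable_norm_iff.mpr h₁.summable
  have n₂ := summable_norm_iff.mpr h₂.summable
  have h := tsum_mul_tsum_eq_tsum_sum_antidiagonal_of_summable_norm n₁ n₂
  have hs := (summable_norm_sum_mul_antidiagonal_of_summable_norm n₁ n₂).of_norm.hasSum
  rw [← h, h₁.tsum_eq, h₂.tsum_eq] at hs
  have e : (fun k : ℕ => ((coeff k (p * q) : ℝ) : ℂ) * z ^ k) = fun k =>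
      ∑ x ∈ antidiagonal k, ((coeff x.1 p : ℝ) : ℂ) * z ^ x.1 *
        (((coeff x.2 q : ℝ) : ℂ) * z ^ x.2) := by
    funext k
    rw [coeff_mul, Complex.ofReal_sum, Finset.sum_mul]
    refine Finset.sum_congr rfl fun x hx => ?_
    rw [← mem_antidiagonal.mp hx, pow_add]
    push_cast
    ring
  rw [e]
  exact hs

open PowerSeries in
theorem eq_of_hasSum_coeff {p q : PowerSeries ℝ} {f : ℂ → ℂ}
    (hp : ∀ᶠ z : ℂ in nhds 0, HasSum (fun k : ℕ => ((coeff k p : ℝ) : ℂ) * z ^ k) (f z))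
    (hq : ∀ᶠ z : ℂ in nhds 0, HasSum (fun k : ℕ => ((coeff k q : ℝ) : ℂ) * z ^ k) (f z)) :
    p = q := by
  have key : ∀ r : PowerSeries ℝ,
      (∀ᶠ z : ℂ in nhds 0, HasSum (fun k : ℕ => ((coeff k r : ℝ) : ℂ) * z ^ k) (f z)) →
      HasFPowerSeriesAt f (FormalMultilinearSeries.ofScalars ℂ fun k => ((coeff k r : ℝ) : ℂ)) 0 := by
    intro r hr
    rw [hasFPowerSeriesAt_iff]
    filter_upwards [hr] with z hz
    simpa [FormalMultilinearSeries.coeff_ofScalars, mul_comm] using hz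
  have h := (key p hp).eq_formalMultilinearSeries (key q hq)
  ext k
  have := congrArg (fun s => FormalMultilinearSeries.coeff s k) h
  simpa [FormalMultilinearSeries.coeff_ofScalars] using this

open PowerSeries in
theorem hasSum_coeff_of_finite {p : PowerSeries ℝ} {N : ℕ} (h : ∀ k, N ≤ k → coeff k p = 0)
    (z : ℂ) :
    HasSum (fun k : ℕ => ((coeff k p : ℝ) : ℂ) * z ^ k)
      (∑ k ∈ range N, ((coeff k p : ℝ) : ℂ) * z ^ k) := by
  refine hasSum_sum_of_ne_finset_zero fun k hk => ?_
  rw [h k (by simpa using hk)]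
  simp

open PowerSeries in
theorem eq_of_sq_eq_sq_of_constantCoeff {p q : PowerSeries ℝ} (h : p ^ 2 = q ^ 2)
    (hp : constantCoeff p = 1) (hq : constantCoeff q = 1) : p = q := by
  rcases sq_eq_sq_iff_eq_or_eq_neg.mp h with h | h
  · exact h
  · have := congrArg constantCoeff h
    rw [map_neg, hp, hq] at this
    norm_num at this

/-- The coefficients of `√(1 - X)`. -/
noncomputable def sqrtOneSubCoeff : ℕ → ℝ
  | 0 => 1
  | k + 1 => sqrtOneSubCoeff k * ((k - 1 / 2) / (k + 1))

/-- The power series `√(1 - X)`. -/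
noncomputable def sqrtOneSub : PowerSeries ℝ := PowerSeries.mk sqrtOneSubCoeff

theorem sqrtOneSubCoeff_succ_neg (k : ℕ) : sqrtOneSubCoeff (k + 1) < 0 := by
  induction k with
  | zero => norm_num [sqrtOneSubCoeff]
  | succ k ih =>
    rw [sqrtOneSubCoeff]
    refine mul_neg_of_neg_of_pos ih (div_pos ?_ (by positivity))
    push_cast
    linarith [k.cast_nonneg (α := ℝ)]

theorem sqrtOneSubCoeff_lt_succ (k : ℕ) :
    sqrtOneSubCoeff (k + 1) < sqrtOneSubCoeff (k + 2) := by
  have h := sqrtOneSubCoeff_succ_neg k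
  rw [sqrtOneSubCoeff.eq_def (k + 2)]
  have : (((k + 1 : ℕ) : ℝ) - 1 / 2) / ((k + 1 : ℕ) + 1) < 1 := by
    rw [div_lt_one (by positivity)]
    linarith
  nlinarith

open PowerSeries in
theorem one_sub_mul_derivative_sqrtOneSub :
    2 * (1 - X) * derivative ℝ sqrtOneSub = - sqrtOneSub := by
  ext k
  have e : 2 * (1 - X) * derivative ℝ sqrtOneSub
    = C (2 : ℝ) * (derivative ℝ sqrtOneSub - X * derivative ℝ sqrtOneSub) := by
    rw [map_ofNat]; ring
  rw [e]
  cases k with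
  | zero =>
    rw [coeff_C_mul, map_sub, coeff_zero_X_mul, coeff_derivative]
    norm_num [sqrtOneSub, sqrtOneSubCoeff]
  | succ k =>
    rw [coeff_C_mul, map_sub, coeff_succ_X_mul]
    simp only [sqrtOneSub, coeff_derivative, coeff_mk, map_neg, sqrtOneSubCoeff]
    push_cast
    field_simp
    ring

open PowerSeries in
theorem sqrtOneSub_sq : sqrtOneSub ^ 2 = 1 - X := by
  have hd := one_sub_mul_derivative_sqrtOneSub
  have h : derivative ℝ (sqrtOneSub ^ 2) - X * derivative ℝ (sqrtOneSub ^ 2)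
      = - sqrtOneSub ^ 2 := by
    rw [sq, Derivation.leibniz, smul_eq_mul]
    linear_combination sqrtOneSub * hd
  have hk : ∀ k : ℕ, (k + 1 : ℝ) * coeff (k + 1) (sqrtOneSub ^ 2)
      = (k - 1) * coeff k (sqrtOneSub ^ 2) := by
    intro k
    have e := congrArg (coeff k) h
    cases k with
    | zero =>
      rw [map_sub, coeff_zero_X_mul, coeff_derivative, map_neg] at e
      push_cast at e ⊢
      linarith
    | succ k =>
      rw [map_sub, coeff_succ_X_mul, coeff_derivative, coeff_derivative, map_neg] at e
      push_cast at e ⊢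
      linarith
  have h0 : coeff 0 (sqrtOneSub ^ 2) = 1 := by simp [sqrtOneSub, sqrtOneSubCoeff]
  have h1 : coeff 1 (sqrtOneSub ^ 2) = -1 := by
    have := hk 0
    rw [h0] at this
    push_cast at this
    linarith
  have h2 : ∀ k, coeff (k + 2) (sqrtOneSub ^ 2) = 0 := by
    intro k
    have e := hk (k + 1)
    have hz : (((k + 1 : ℕ) : ℝ) - 1) * coeff (k + 1) (sqrtOneSub ^ 2) = 0 := by
      induction k with
      | zero => simp
      | succ k ih =>
        have e' := hk (k + 1)
        rw [ih e'] at e'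
        rw [(mul_eq_zero.mp e').resolve_left (by positivity), mul_zero]
    rw [hz] at e
    exact (mul_eq_zero.mp e).resolve_left (by positivity)
  ext k
  match k with
  | 0 => simpa using h0
  | 1 => simpa [coeff_one] using h1
  | k + 2 => simp [h2, coeff_one, coeff_X]

open PowerSeries in
theorem coeff_X_mul_derivative (p : PowerSeries ℝ) (k : ℕ) :
    coeff k (X * derivative ℝ p) = k * coeff k p := by
  cases k with
  | zero => simp
  | succ k =>
    rw [coeff_succ_X_mul, coeff_derivative]
    push_cast
    ring

open PowerSeries in
theorem derivative_of_sq_eq {p : PowerSeries ℝ} (hp : p ^ 2 = 1 + X + X ^ 2) :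
    2 * (1 + X + X ^ 2) * derivative ℝ p = (1 + 2 * X) * p := by
  have hne : p ≠ 0 := by
    rintro rfl
    have := congrArg constantCoeff hp
    simp at this
  have hd := congrArg (derivative ℝ) hp
  rw [sq, Derivation.leibniz, smul_eq_mul, map_add, map_add, sq (X : PowerSeries ℝ),
    Derivation.leibniz, smul_eq_mul, derivative_X, ← map_one (C (R := ℝ)),
    derivative_C, map_one] at hd
  refine mul_left_cancel₀ hne ?_
  rw [← hp]
  linear_combination p ^ 2 * hd

open PowerSeries in
theorem coeff_recurrence_of_sq_eq {p : PowerSeries ℝ} (hp : p ^ 2 = 1 + X + X ^ 2) :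
    coeff 1 p = coeff 0 p / 2 ∧ ∀ k : ℕ, (k + 2 : ℝ) * coeff (k + 2) p
      = -(k + 1 / 2) * coeff (k + 1) p - (k - 1) * coeff k p := by
  have h := derivative_of_sq_eq hp
  have e : C (2 : ℝ) * (derivative ℝ p + X * derivative ℝ p + X * (X * derivative ℝ p))
      = p + C (2 : ℝ) * (X * p) := by
    rw [map_ofNat]
    linear_combination h
  constructor
  · have := congrArg (coeff 0) e
    rw [coeff_C_mul, map_add, map_add, map_add, coeff_C_mul, coeff_zero_X_mul, coeff_zero_X_mul,
      coeff_zero_X_mul, coeff_derivative] at this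
    push_cast at this
    linarith
  · intro k
    have := congrArg (coeff (k + 1)) e
    rw [coeff_C_mul, map_add, map_add, map_add, coeff_C_mul, coeff_succ_X_mul, coeff_succ_X_mul,
      coeff_succ_X_mul, coeff_X_mul_derivative, coeff_derivative, coeff_derivative] at this
    push_cast at this
    linarith

/-- The truncation to degree at most `n` of the power series with coefficients `b`. -/
noncomputable def truncSeries (b : ℕ → ℝ) (n : ℕ) : PowerSeries ℝ :=
  PowerSeries.mk fun k => if k ≤ n then b k else 0

open PowerSeries in
theorem truncSeries_derivative {b : ℕ → ℝ} (h1 : b 1 = b 0 / 2)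
    (hrec : ∀ k : ℕ, (k + 2 : ℝ) * b (k + 2) = -(k + 1 / 2) * b (k + 1) - (k - 1) * b k)
    (n : ℕ) :
    2 * (1 + X + X ^ 2) * derivative ℝ (truncSeries b n) - (1 + 2 * X) * truncSeries b n
      = 2 * (C (-(n + 1) * b (n + 1)) * X ^ n + C ((n - 1) * b n) * X ^ (n + 1)) := by
  set p := truncSeries b n with hp
  have hc : ∀ k, coeff k p = if k ≤ n then b k else 0 := fun k => by
    rw [hp, truncSeries, coeff_mk]
  have e : C (2 : ℝ) * (derivative ℝ p + X * derivative ℝ p + X * (X * derivative ℝ p)) -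
      (p + C (2 : ℝ) * (X * p))
      = C (2 : ℝ) * (C (-(n + 1) * b (n + 1)) * X ^ n + C ((n - 1) * b n) * X ^ (n + 1)) := by
    ext k
    cases k with
    | zero =>
      rw [map_sub, coeff_C_mul, map_add, map_add, map_add, coeff_C_mul, coeff_zero_X_mul,
        coeff_zero_X_mul, coeff_zero_X_mul, coeff_derivative, coeff_C_mul, map_add, coeff_C_mul,
        coeff_C_mul, coeff_X_pow, coeff_X_pow, hc, hc]
      cases n with
      | zero => simp [h1]; ring
      | succ n => simp [h1]; ring
    | succ k =>
      rw [map_sub, coeff_C_mul, map_add, map_add, map_add, coeff_C_mul, coeff_succ_X_mul,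
        coeff_succ_X_mul, coeff_succ_X_mul, coeff_X_mul_derivative, coeff_derivative,
        coeff_derivative, coeff_C_mul, map_add, coeff_C_mul,
        coeff_C_mul, coeff_X_pow, coeff_X_pow, hc, hc, hc]
      have hk := hrec k
      push_cast
      rcases lt_trichotomy (k + 1) n with h | h | h
      · rw [if_pos (by omega), if_pos (by omega), if_pos (by omega), if_neg (by omega),
          if_neg (by omega)]
        linarith
      · subst h
        rw [if_neg (by omega), if_pos le_rfl, if_pos (by omega), if_pos rfl, if_neg (by omega)]
        push_cast
        linarith
      · rcases (show k = n ∨ n < k by omega) with h | h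
        · subst h
          rw [if_neg (by omega), if_neg (by omega), if_pos le_rfl, if_neg (by omega),
            if_pos rfl]
          ring
        · rw [if_neg (by omega), if_neg (by omega), if_neg (by omega), if_neg (by omega),
            if_neg (by omega)]
          ring
  rw [map_ofNat] at e
  linear_combination e

open PowerSeries in
theorem coeff_mul_sqrtOneSub_recurrence {p r : PowerSeries ℝ}
    (h : 2 * (1 + X + X ^ 2) * derivative ℝ p - (1 + 2 * X) * p = 2 * r) (k : ℕ) :
    2 * (k + 3 : ℝ) * coeff (k + 3) (p * sqrtOneSub)
      = (2 * k - 3) * coeff k (p * sqrtOneSub)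
        + 2 * coeff (k + 2) (r * ((1 - X) * sqrtOneSub)) := by
  have hd := one_sub_mul_derivative_sqrtOneSub
  set q := p * sqrtOneSub with hq
  have hq' : derivative ℝ q = p * derivative ℝ sqrtOneSub + sqrtOneSub * derivative ℝ p := by
    rw [hq, Derivation.leibniz, smul_eq_mul, smul_eq_mul]
  have e : C (2 : ℝ) * (derivative ℝ q - X ^ 2 * (X * derivative ℝ q)) + C (3 : ℝ) * (X ^ 2 * q)
      = C (2 : ℝ) * (r * ((1 - X) * sqrtOneSub)) := by
    rw [map_ofNat, map_ofNat, hq', hq]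
    linear_combination (1 - X) * sqrtOneSub * h + (1 + X + X ^ 2) * p * hd
  have := congrArg (coeff (k + 2)) e
  rw [map_add, coeff_C_mul, coeff_C_mul, coeff_C_mul, map_sub, coeff_X_pow_mul, coeff_X_pow_mul,
    coeff_X_mul_derivative, coeff_derivative] at this
  push_cast at this
  linarith

theorem recurrence_bounds {b s : ℕ → ℝ} (h0 : b 0 = 1) (h1 : b 1 = 1 / 2)
    (hrec : ∀ k : ℕ, (k + 2 : ℝ) * b (k + 2) = -(k + 1 / 2) * b (k + 1) - (k - 1) * b k)
    (s3 : s 3 = -1 / 2)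
    (hs : ∀ k : ℕ, 2 * (k + 3 : ℝ) * s (k + 3) = (2 * k - 3) * s k) (i : ℕ) :
    s (3 * i + 3) < 0 ∧ 3 * s (3 * i + 3) ≥ 8 * b (3 * i + 3) ∧
      4 * (3 * i + 2) * -b (3 * i + 3) ≤ (6 * i + 3) * -s (3 * i + 3) ∧
      0 < b (3 * i + 4) ∧ 10 * (3 * i + 4) * b (3 * i + 4) ≤ (6 * i + 3) * -s (3 * i + 3) := by
  induction i with
  | zero =>
    have e2 := hrec 0
    have e3 := hrec 1
    have e4 := hrec 2
    norm_num [h0, h1, s3] at e2 e3 e4 ⊢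
    refine ⟨?_, ?_, ?_, ?_⟩ <;> linarith
  | succ i ih =>
    obtain ⟨a1, a2, a3, a4, a5⟩ := ih
    have e2 := hrec (3 * i + 3)
    have e3 := hrec (3 * i + 4)
    have e4 := hrec (3 * i + 5)
    have es := hs (3 * i + 3)
    rw [show 3 * (i + 1) + 3 = 3 * i + 3 + 3 by ring, show 3 * (i + 1) + 4 = 3 * i + 5 + 2 by ring]
    have n0 : (0 : ℝ) ≤ i := i.cast_nonneg
    simp only [Nat.add_assoc, Nat.reduceAdd] at *
    push_cast at *
    generalize (i : ℝ) = t at *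
    generalize b (3 * i + 3) = y at *
    generalize b (3 * i + 4) = x at *
    generalize b (3 * i + 5) = w at *
    generalize b (3 * i + 6) = y' at *
    generalize b (3 * i + 7) = x' at *
    generalize s (3 * i + 3) = v at *
    generalize s (3 * i + 6) = v' at *
    have f3 : (3 * t + 5) * (3 * t + 6) * y' = 3 / 4 * x + (3 * t + 9 / 2) * (3 * t + 2) * y := by
      linear_combination (3 * t + 5) * e3 - (3 * t + 9 / 2) * e2
    have f4 : (3 * t + 5) * (3 * t + 6) * (3 * t + 7) * x' =
      ((3 * t + 4) * (3 * t + 7 / 2) * (3 * t + 6) - 3 / 4 * (3 * t + 11 / 2)) * x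
       - 3 / 4 * (3 * t + 2) * y := by
      linear_combination (3 * t + 5) * (3 * t + 6) * e4 - (3 * t + 11 / 2) * f3
        - (3 * t + 4) * (3 * t + 6) * e2
    have fs : (3 * t + 6) * v' = (3 * t + 3 / 2) * v := by linarith
    have hx : 5 * x ≤ -v := by
      refine le_of_mul_le_mul_left (a := 2 * (3 * t + 4)) ?_ (by positivity)
      nlinarith
    have hK : 0 < (3 * t + 4) * (3 * t + 7 / 2) * (3 * t + 6) - 3 / 4 * (3 * t + 11 / 2) := by
      nlinarith [pow_nonneg n0 3, pow_nonneg n0 2]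
    refine ⟨?_, ?_, ?_, ?_, ?_⟩
    · refine neg_of_mul_neg_right (a := 3 * t + 6) ?_ (by positivity)
      rw [fs]
      exact mul_neg_of_pos_of_neg (by positivity) a1
    · refine le_of_mul_le_mul_left (a := (3 * t + 5) * (3 * t + 6)) ?_ (by positivity)
      have := mul_nonneg (show 0 ≤ (3 * t + 5) * (3 * t + 3 / 2) by positivity) (sub_nonneg.mpr a2)
      linear_combination this - 3 * (3 * t + 5) * fs + 8 * f3 + 6 / 5 * hx + 3 / 2 * a2
        + 33 / 10 * a1.le
    · refine le_of_mul_le_mul_left (a := 3 * t + 6) ?_ (by positivity)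
      linear_combination (3 * t + 9 / 2) * a3 + 3 * a4.le - 4 * f3 + (6 * t + 9) * fs
    · refine pos_of_mul_pos_right (a := (3 * t + 5) * (3 * t + 6) * (3 * t + 7)) ?_
        (by positivity)
      rw [f4]
      have := mul_pos hK a4
      have := mul_pos (show 0 < 3 * t + 2 by positivity) (show 0 < -y by linarith)
      linarith
    · refine le_of_mul_le_mul_left (a := (3 * t + 4) * ((3 * t + 5) * (3 * t + 6))) ?_
        (by positivity)
      have h₁ := mul_le_mul_of_nonneg_left a5 hK.le
      have h₂ := mul_le_mul_of_nonneg_left a3 (show 0 ≤ 15 / 8 * (3 * t + 4) by positivity)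
      have h₃ := mul_nonneg (show 0 ≤ (3 * t + 4) * (3 * t + 5) * (3 * t + 3 / 2) * (6 * t + 9)
        - (6 * t + 3) * (((3 * t + 4) * (3 * t + 7 / 2) * (3 * t + 6) - 3 / 4 * (3 * t + 11 / 2))
          + 15 / 8 * (3 * t + 4)) by
          ring_nf
          positivity) (show 0 ≤ -v by linarith)
      linear_combination h₁ + h₂ + h₃ + 10 * (3 * t + 4) * f4
        + (6 * t + 9) * (3 * t + 4) * (3 * t + 5) * fs

open PowerSeries in
theorem coeff_truncSeries_mul_congr (b : ℕ → ℝ) (p : PowerSeries ℝ) {n k : ℕ} (h : k ≤ n) :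
    coeff k (truncSeries b n * p) = coeff k (mk b * p) := by
  rw [coeff_mul, coeff_mul]
  refine Finset.sum_congr rfl fun x hx => ?_
  have := mem_antidiagonal.mp hx
  rw [truncSeries, coeff_mk, coeff_mk, if_pos (by omega)]

open PowerSeries in
theorem coeff_truncSeries_succ_mul (b : ℕ → ℝ) (p : PowerSeries ℝ) (n m : ℕ) :
    coeff (m + (n + 1)) (truncSeries b (n + 1) * p)
      = coeff (m + (n + 1)) (truncSeries b n * p) + b (n + 1) * coeff m p := by
  have h : truncSeries b (n + 1) = truncSeries b n + C (b (n + 1)) * X ^ (n + 1) := by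
    ext k
    rw [map_add, coeff_C_mul, coeff_X_pow, truncSeries, truncSeries, coeff_mk, coeff_mk]
    rcases lt_trichotomy k (n + 1) with h | h | h
    · rw [if_pos (by omega), if_pos (by omega), if_neg (by omega)]
      ring
    · rw [if_pos (by omega), if_neg (by omega), if_pos h, h]
      ring
    · rw [if_neg (by omega), if_neg (by omega), if_neg (by omega)]
      ring
  rw [h, add_mul, map_add, mul_assoc, coeff_C_mul, coeff_X_pow_mul]

open PowerSeries in
theorem coeff_one_sub_mul_sqrtOneSub_pos (m : ℕ) :
    0 < coeff (m + 2) ((1 - X) * sqrtOneSub) := by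
  rw [sub_mul, one_mul, map_sub, coeff_succ_X_mul, sqrtOneSub, coeff_mk, coeff_mk]
  exact sub_pos.mpr (sqrtOneSubCoeff_lt_succ m)

open PowerSeries in
theorem coeff_truncSeries_mul_sqrtOneSub_neg {b : ℕ → ℝ} {i : ℕ} (h1 : b 1 = b 0 / 2)
    (hrec : ∀ k : ℕ, (k + 2 : ℝ) * b (k + 2) = -(k + 1 / 2) * b (k + 1) - (k - 1) * b k)
    {s : ℕ → ℝ} (hs : s = fun k => coeff k (mk b * sqrtOneSub))
    (s1 : s (3 * i + 1) = 0) (s2 : s (3 * i + 2) = 0) (s3 : s (3 * i + 3) < 0)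
    (hy : 3 * s (3 * i + 3) ≥ 8 * b (3 * i + 3))
    (hy' : 4 * (3 * i + 2) * -b (3 * i + 3) ≤ (6 * i + 3) * -s (3 * i + 3))
    (hx : 0 < b (3 * i + 4))
    (hx' : 10 * (3 * i + 4) * b (3 * i + 4) ≤ (6 * i + 3) * -s (3 * i + 3)) (m : ℕ) :
    coeff (m + (3 * i + 4)) (truncSeries b (3 * i + 3) * sqrtOneSub) < 0 := by
  have n0 : (0 : ℝ) ≤ i := i.cast_nonneg
  have hR := fun k => coeff_mul_sqrtOneSub_recurrence
    (truncSeries_derivative h1 hrec (3 * i + 3)) k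
  have hE := coeff_one_sub_mul_sqrtOneSub_pos
  have hE0 : coeff 0 ((1 - X) * sqrtOneSub) = 1 := by
    rw [sub_mul, one_mul, map_sub, coeff_zero_X_mul, sqrtOneSub, coeff_mk]
    norm_num [sqrtOneSubCoeff]
  have hE1 : coeff 1 ((1 - X) * sqrtOneSub) = -(3 / 2) := by
    rw [sub_mul, one_mul, map_sub, coeff_succ_X_mul, sqrtOneSub, coeff_mk, coeff_mk]
    norm_num [sqrtOneSubCoeff]
  have hE2 : coeff 2 ((1 - X) * sqrtOneSub) = 3 / 8 := by
    rw [sub_mul, one_mul, map_sub, coeff_succ_X_mul, sqrtOneSub, coeff_mk, coeff_mk]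
    norm_num [sqrtOneSubCoeff]
  have hg : ∀ k ≤ 3 * i + 3, coeff k (truncSeries b (3 * i + 3) * sqrtOneSub) = s k := by
    intro k hk
    rw [hs, coeff_truncSeries_mul_congr b _ hk]
  generalize truncSeries b (3 * i + 3) * sqrtOneSub = g at *
  generalize (1 - X) * sqrtOneSub = E at *
  have hdist : ∀ c d : ℝ, (C c * X ^ (3 * i + 3) + C d * X ^ (3 * i + 3 + 1)) * E
      = C c * (X ^ (3 * i + 3) * E) + C d * (X ^ (3 * i + 4) * E) := fun c d => by ring
  simp only [hdist, map_add, coeff_C_mul, Nat.add_assoc, Nat.reduceAdd] at hR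
  have hc0 : coeff (3 * i + 3) (X ^ (3 * i + 3) * E) = coeff 0 E := by
    simpa using coeff_X_pow_mul E (3 * i + 3) 0
  have hc0' : coeff (3 * i + 3) (X ^ (3 * i + 4) * E) = 0 := by
    rw [coeff_X_pow_mul', if_neg (by omega)]
  have hc : ∀ j, coeff (3 * i + (j + 3)) (X ^ (3 * i + 3) * E) = coeff j E := by
    intro j
    rw [show 3 * i + (j + 3) = j + (3 * i + 3) by ring, coeff_X_pow_mul]
  have hc' : ∀ j, coeff (3 * i + (j + 4)) (X ^ (3 * i + 4) * E) = coeff j E := by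
    intro j
    rw [show 3 * i + (j + 4) = j + (3 * i + 4) by ring, coeff_X_pow_mul]
  have hyneg : b (3 * i + 3) < 0 := by linarith
  have g0 : coeff (3 * i + 4) g < 0 := by
    have h := hR (3 * i + 1)
    rw [hg (3 * i + 1) (by omega), s1] at h
    simp only [Nat.add_assoc, Nat.reduceAdd] at h
    rw [hc0, hc0', hE0] at h
    push_cast at h
    have := mul_pos (show 0 < 3 * (i : ℝ) + 4 by positivity) hx
    refine neg_of_mul_neg_right (a := 2 * (3 * (i : ℝ) + 4)) ?_ (by positivity)
    linarith
  have g1 : coeff (3 * i + 5) g < 0 := by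
    have h := hR (3 * i + 2)
    rw [hg (3 * i + 2) (by omega), s2] at h
    simp only [Nat.add_assoc, Nat.reduceAdd] at h
    rw [hc 1, hc' 0, hE0, hE1] at h
    push_cast at h
    refine neg_of_mul_neg_right (a := 2 * (3 * (i : ℝ) + 5)) ?_ (by positivity)
    have := mul_nonneg (show 0 ≤ 3 * (i : ℝ) + 2 by positivity) (sub_nonneg.mpr hy)
    nlinarith [mul_nonneg n0 (neg_nonneg.mpr s3.le)]
  have g2 : coeff (3 * i + 6) g < 0 := by
    have h := hR (3 * i + 3)
    rw [hg (3 * i + 3) (by omega)] at h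
    simp only [Nat.add_assoc, Nat.reduceAdd] at h
    rw [hc 2, hc' 1, hE2, hE1] at h
    push_cast at h
    refine neg_of_mul_neg_right (a := 2 * (3 * (i : ℝ) + 6)) ?_ (by positivity)
    have := mul_pos (show 0 < 3 * (i : ℝ) + 4 by positivity) hx
    nlinarith [mul_nonneg n0 (neg_nonneg.mpr s3.le)]
  have step : ∀ m, coeff (3 * i + (m + 4)) g < 0 → coeff (3 * i + (m + 7)) g < 0 := by
    intro m hm
    have h := hR (3 * i + (m + 4))
    simp only [Nat.add_assoc, Nat.reduceAdd] at h
    rw [hc (m + 3), hc' (m + 2)] at h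
    push_cast at h
    refine neg_of_mul_neg_right (a := 2 * (3 * (i : ℝ) + (m + 4) + 3)) ?_ (by positivity)
    have p1 := mul_neg_of_pos_of_neg
      (show 0 < 2 * (3 * (i : ℝ) + (m + 4)) - 3 by
        linarith [n0, m.cast_nonneg (α := ℝ)]) hm
    have p2 := mul_pos (mul_pos (show 0 < 3 * (i : ℝ) + 4 by positivity) hx) (hE (m + 1))
    have p3 := mul_neg_of_neg_of_pos
      (mul_neg_of_pos_of_neg (show 0 < 3 * (i : ℝ) + 2 by positivity) hyneg) (hE m)
    simp only [Nat.add_assoc, Nat.reduceAdd] at p2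
    linarith
  have all : ∀ m, coeff (3 * i + (m + 4)) g < 0 ∧ coeff (3 * i + (m + 5)) g < 0 ∧
      coeff (3 * i + (m + 6)) g < 0 := by
    intro m
    induction m with
    | zero => exact ⟨by simpa using g0, by simpa using g1, by simpa using g2⟩
    | succ m ih =>
      refine ⟨?_, ?_, ?_⟩
      · rw [show m + 1 + 4 = m + 5 by ring]; exact ih.2.1
      · rw [show m + 1 + 5 = m + 6 by ring]; exact ih.2.2
      · rw [show m + 1 + 6 = m + 7 by ring]; exact step m ih.1
  rw [show m + (3 * i + 4) = 3 * i + (m + 4) by ring]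
  exact (all m).1

open PowerSeries in
theorem coeff_truncSeries_mul_sqrtOneSub {p : PowerSeries ℝ} (hp : p ^ 2 = 1 + X + X ^ 2)
    (hp0 : constantCoeff p = 1) (n : ℕ) :
    (∀ k, 1 ≤ k → k ≤ n →
      coeff k (truncSeries (fun j => coeff j p) n * sqrtOneSub) ≤ 0) ∧
    ∀ m, coeff (m + (n + 1)) (truncSeries (fun j => coeff j p) n * sqrtOneSub) < 0 := by
  obtain ⟨h1, hrec⟩ := coeff_recurrence_of_sq_eq hp
  have hpm : mk (fun j => coeff j p) = p := by ext; simp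
  have h0 : coeff 0 p = 1 := by simpa using hp0
  set b : ℕ → ℝ := fun j => coeff j p with hb
  set s : ℕ → ℝ := fun k => coeff k (mk b * sqrtOneSub) with hs
  have hsrec : ∀ k : ℕ, 2 * (k + 3 : ℝ) * s (k + 3) = (2 * k - 3) * s k := by
    intro k
    have h := coeff_mul_sqrtOneSub_recurrence (p := p) (r := 0) (by
      rw [derivative_of_sq_eq hp]; ring) k
    simpa [hs, hpm] using h
  have hb2 : coeff 2 p = 3 / 8 := by
    have := hrec 0
    norm_num [h1, h0] at this
    linarith
  have ha : ∀ k, coeff k sqrtOneSub = sqrtOneSubCoeff k := fun k => by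
    rw [sqrtOneSub, coeff_mk]
  have s0 : s 0 = 1 := by
    simp [hs, hpm, hp0, sqrtOneSub, sqrtOneSubCoeff]
  have s1 : s 1 = 0 := by
    simp only [hs, hpm, coeff_mul, Nat.sum_antidiagonal_eq_sum_range_succ_mk, ha,
      sum_range_succ, sum_range_zero, h0, h1]
    norm_num [sqrtOneSubCoeff]
  have s2 : s 2 = 0 := by
    simp only [hs, hpm, coeff_mul, Nat.sum_antidiagonal_eq_sum_range_succ_mk, ha,
      sum_range_succ, sum_range_zero, h0, h1, hb2]
    norm_num [sqrtOneSubCoeff]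
  have s3 : s 3 = -1 / 2 := by
    have := hsrec 0
    norm_num [s0] at this
    linarith
  have hs1 : ∀ i, s (3 * i + 1) = 0 ∧ s (3 * i + 2) = 0 := by
    intro i
    induction i with
    | zero => exact ⟨s1, s2⟩
    | succ i ih =>
      have e1 := hsrec (3 * i + 1)
      have e2 := hsrec (3 * i + 2)
      rw [ih.1, mul_zero] at e1
      rw [ih.2, mul_zero] at e2
      exact ⟨(mul_eq_zero.mp e1).resolve_left (by positivity),
        (mul_eq_zero.mp e2).resolve_left (by positivity)⟩
  have hbd := recurrence_bounds (b := b) h0 (by rw [hb]; linarith) hrec s3 hsrec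
  have base : ∀ i m, coeff (m + (3 * i + 1)) (truncSeries b (3 * i) * sqrtOneSub) < 0 := by
    intro i m
    cases i with
    | zero =>
      have : truncSeries b 0 = 1 := by
        ext k
        rw [truncSeries, coeff_mk, coeff_one]
        by_cases hk : k = 0
        · simp [hk, hb, hp0]
        · simp [hk]
      rw [this, one_mul, sqrtOneSub, coeff_mk]
      exact sqrtOneSubCoeff_succ_neg m
    | succ i =>
      obtain ⟨c1, c2, c3, c4, c5⟩ := hbd i
      exact coeff_truncSeries_mul_sqrtOneSub_neg h1 hrec hs (hs1 i).1 (hs1 i).2 c1 c2 c3 c4 c5 m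
  have hbpos : ∀ i, 0 < b (3 * i + 1) ∧ 0 < b (3 * i + 2) := by
    intro i
    cases i with
    | zero => constructor <;> norm_num [hb, h1, h0, hb2]
    | succ i =>
      obtain ⟨c1, c2, c3, c4, c5⟩ := hbd i
      refine ⟨c4, ?_⟩
      have e := hrec (3 * i + 3)
      have n0 : (0 : ℝ) ≤ i := i.cast_nonneg
      refine pos_of_mul_pos_right (a := 3 * (i : ℝ) + 5) ?_ (by positivity)
      have := mul_nonneg (show 0 ≤ 3 * (i : ℝ) + 2 by positivity) (sub_nonneg.mpr c2)
      have e' : (3 * (i : ℝ) + 5) * b (3 * (i + 1) + 2)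
          = -(3 * i + 7 / 2) * b (3 * i + 4) - (3 * i + 2) * b (3 * i + 3) := by
        push_cast at e
        linear_combination e
      rw [e']
      nlinarith [mul_nonneg n0 (neg_nonneg.mpr c1.le)]
  have step : ∀ j, 0 < b (j + 1) →
      (∀ m, coeff (m + (j + 1)) (truncSeries b j * sqrtOneSub) < 0) →
      ∀ m, coeff (m + (j + 2)) (truncSeries b (j + 1) * sqrtOneSub) < 0 := by
    intro j hj h m
    have e := coeff_truncSeries_succ_mul b sqrtOneSub j (m + 1)
    rw [ha] at e
    rw [show m + (j + 2) = m + 1 + (j + 1) by ring, e]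
    exact add_neg (h _) (mul_neg_of_pos_of_neg hj (sqrtOneSubCoeff_succ_neg m))
  refine ⟨fun k hk hkn => ?_, ?_⟩
  · rw [coeff_truncSeries_mul_congr b _ hkn]
    change s k ≤ 0
    obtain ⟨i, rfl | rfl | rfl⟩ : ∃ i, k = 3 * i + 1 ∨ k = 3 * i + 2 ∨ k = 3 * i + 3 :=
      ⟨(k - 1) / 3, by omega⟩
    · exact (hs1 i).1.le
    · exact (hs1 i).2.le
    · exact (hbd i).1.le
  · obtain ⟨i, rfl | rfl | rfl⟩ : ∃ i, n = 3 * i ∨ n = 3 * i + 1 ∨ n = 3 * i + 2 :=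
      ⟨n / 3, by omega⟩
    · exact base i
    · exact step _ (hbpos i).1 (base i)
    · exact step _ (hbpos i).2 (step _ (hbpos i).1 (base i))

/-- Let `b_k` be the Taylor coefficients of the principal branch of
`√(1+z+z²)`, `T_n(z) = ∑_{k=0}^n b_k z^k`, and let `γ_k` be the Taylor coefficients at
`0` of `T_n(z)√(1-z)`. Then `γ_k ≤ 0` for every `k ≥ 1`, and `γ_k < 0` for every
`k ≥ n + 1`. -/
theorem product_coeff_nonpositive
    (b : ℕ → ℝ)
    (hb : ∀ᶠ z : ℂ in nhds 0,
      HasSum (fun k : ℕ => (b k : ℂ) * z ^ k) ((1 + z + z ^ 2) ^ ((1 : ℂ) / 2)))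
    (n : ℕ) (γ : ℕ → ℝ)
    (hγ : ∀ᶠ z : ℂ in nhds 0,
      HasSum (fun k : ℕ => (γ k : ℂ) * z ^ k)
        ((∑ k ∈ Finset.range (n + 1), (b k : ℂ) * z ^ k) * (1 - z) ^ ((1 : ℂ) / 2))) :
    (∀ k : ℕ, 1 ≤ k → γ k ≤ 0) ∧ (∀ k : ℕ, n + 1 ≤ k → γ k < 0) := by
  have hsq : ∀ w : ℂ, w ^ ((1 : ℂ) / 2) * w ^ ((1 : ℂ) / 2) = w := fun w => by
    rw [← sq, one_div]
    exact_mod_cast Complex.cpow_nat_inv_pow w two_ne_zero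
  have hb' : ∀ᶠ z : ℂ in nhds 0, HasSum
      (fun k : ℕ => ((PowerSeries.coeff k (PowerSeries.mk b) : ℝ) : ℂ) * z ^ k)
      ((1 + z + z ^ 2) ^ ((1 : ℂ) / 2)) := by
    simpa only [PowerSeries.coeff_mk] using hb
  have hγ' : ∀ᶠ z : ℂ in nhds 0, HasSum
      (fun k : ℕ => ((PowerSeries.coeff k (PowerSeries.mk γ) : ℝ) : ℂ) * z ^ k)
      ((∑ k ∈ Finset.range (n + 1), (b k : ℂ) * z ^ k) * (1 - z) ^ ((1 : ℂ) / 2)) := by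
    simpa only [PowerSeries.coeff_mk] using hγ
  have b0 : b 0 = 1 := by
    have h := (hasSum_single 0 (f := fun k : ℕ => (b k : ℂ) * 0 ^ k) (by simp +contextual)).unique
      hb.self_of_nhds
    simpa using h
  have γ0 : γ 0 = 1 := by
    have h := (hasSum_single 0 (f := fun k : ℕ => (γ k : ℂ) * 0 ^ k) (by simp +contextual)).unique
      hγ.self_of_nhds
    simpa [Finset.sum_range_succ', b0] using h
  have hB : (PowerSeries.mk b) ^ 2 = 1 + PowerSeries.X + PowerSeries.X ^ 2 := by
    refine eq_of_hasSum_coeff (f := fun z => 1 + z + z ^ 2) ?_ (.of_forall fun z => ?_)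
    · simpa only [hsq, ← sq] using hasSum_coeff_mul hb' hb'
    · have h := hasSum_coeff_of_finite (p := 1 + PowerSeries.X + PowerSeries.X ^ 2) (N := 3)
        (fun k hk => by
          simp [PowerSeries.coeff_one, PowerSeries.coeff_X, PowerSeries.coeff_X_pow,
            show k ≠ 0 by omega, show k ≠ 1 by omega, show k ≠ 2 by omega]) z
      simpa [Finset.sum_range_succ, PowerSeries.coeff_one, PowerSeries.coeff_X,
        PowerSeries.coeff_X_pow] using h
  have hT : ∀ᶠ z : ℂ in nhds 0, HasSum
      (fun k : ℕ => ((PowerSeries.coeff k (truncSeries b n) : ℝ) : ℂ) * z ^ k)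
      (∑ k ∈ Finset.range (n + 1), (b k : ℂ) * z ^ k) := by
    refine .of_forall fun z => ?_
    have h := hasSum_coeff_of_finite (p := truncSeries b n) (N := n + 1) (fun k hk => by
      rw [truncSeries, PowerSeries.coeff_mk, if_neg (by omega)]) z
    convert h using 1
    refine Finset.sum_congr rfl fun k hk => ?_
    rw [truncSeries, PowerSeries.coeff_mk, if_pos (Nat.lt_succ_iff.mp (mem_range.mp hk))]
  have hX : ∀ᶠ z : ℂ in nhds 0, HasSum
      (fun k : ℕ => ((PowerSeries.coeff k (1 - PowerSeries.X : PowerSeries ℝ) : ℝ) : ℂ) * z ^ k)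
      (1 - z) := by
    refine .of_forall fun z => ?_
    have h := hasSum_coeff_of_finite (p := 1 - PowerSeries.X) (N := 2) (fun k hk => by
      simp [PowerSeries.coeff_one, PowerSeries.coeff_X, show k ≠ 0 by omega,
        show k ≠ 1 by omega]) z
    simpa [Finset.sum_range_succ, PowerSeries.coeff_one, PowerSeries.coeff_X,
      sub_eq_add_neg] using h
  have hΓ : (PowerSeries.mk γ) ^ 2 = (truncSeries b n * sqrtOneSub) ^ 2 := by
    rw [mul_pow, sqrtOneSub_sq, sq, sq]
    refine eq_of_hasSum_coeff (hasSum_coeff_mul hγ' hγ') ?_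
    filter_upwards [hasSum_coeff_mul (hasSum_coeff_mul hT hT) hX] with z hz
    rwa [mul_mul_mul_comm, hsq]
  have hΓ' : PowerSeries.mk γ = truncSeries b n * sqrtOneSub := by
    refine eq_of_sq_eq_sq_of_constantCoeff hΓ (by simpa using γ0) ?_
    simp [truncSeries, sqrtOneSub, sqrtOneSubCoeff, b0]
  have hγc : ∀ k, γ k = PowerSeries.coeff k (truncSeries b n * sqrtOneSub) := fun k => by
    rw [← hΓ', PowerSeries.coeff_mk]
  have main := coeff_truncSeries_mul_sqrtOneSub hB (by simpa using b0) n
  simp only [PowerSeries.coeff_mk] at main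
  have hneg : ∀ k, n + 1 ≤ k → γ k < 0 := by
    intro k hk
    obtain ⟨m, rfl⟩ := Nat.exists_eq_add_of_le' hk
    rw [hγc]
    exact main.2 m
  refine ⟨fun k hk => ?_, hneg⟩
  rcases le_or_gt k n with h | h
  · rw [hγc]
    exact main.1 k hk h
  · exact (hneg k h).le
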